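/- Let (f_n)_{n ∈ ℕ} be a sequence of unit vectors in a Hilbert space H such that there exists a constant B > 0 with ∑_{k=0}^∞ |⟨f_j, f_k⟩| ≤ B for every j ∈ ℕ (a Bessel–Schur sequence). Then ℕ can be partitioned into finitely many subsets I_1, …, I_N such that for each p, the subsequence (f_n)_{n ∈ I_p} is a Riesz sequence. -/

import Mathlib

open scoped InnerProductSpace

/-- The sum of a symmetric kernel vanishing at `(j, j)`, with the row and column of `j` split off. -/
theorem sum_sum_eq_erase_add_two_mul {ι : Type*} [Fintype ι] [DecidableEq ι] (g : ι → ι → ℝ)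
    (hsymm : ∀ x y, g x y = g y x) (j : ι) (hj : g j j = 0) :
    ∑ x, ∑ y, g x y =
      ∑ x ∈ Finset.univ.erase j, ∑ y ∈ Finset.univ.erase j, g x y + 2 * ∑ y, g j y := by
  have hrow : ∀ x, ∑ y, g x y = ∑ y ∈ Finset.univ.erase j, g x y + g x j := fun x =>
    (Finset.sum_erase_add _ _ (Finset.mem_univ j)).symm
  rw [← Finset.sum_erase_add _ _ (Finset.mem_univ j), Finset.sum_congr rfl fun x _ => hrow x,
    Finset.sum_add_distrib, Finset.sum_congr rfl fun x _ => hsymm x j, hrow j, hj]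
  ring

/-- A finite weighted graph whose weighted degrees are at most `B` has an `N`-coloring in which
every vertex has weighted degree at most `B / N` within its own color class. -/
theorem exists_coloring_sum_le {ι κ : Type*} [Fintype ι] [DecidableEq ι] [Fintype κ] [Nonempty κ]
    [DecidableEq κ] (w : ι → ι → ℝ) (hsymm : ∀ x y, w x y = w y x) (hdiag : ∀ x, w x x = 0)
    {B : ℝ} (hB : ∀ x, ∑ y, w x y ≤ B) :
    ∃ P : ι → κ, ∀ j, Fintype.card κ * ∑ k, (if P j = P k then w j k else 0) ≤ B := by
  obtain ⟨P, hP⟩ := Finite.exists_min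
    (fun P : ι → κ => ∑ x, ∑ y, if P x = P y then w x y else 0)
  refine ⟨P, fun j => ?_⟩
  have hmove : ∀ i : κ, ∑ k, (if P j = P k then w j k else 0) ≤
      ∑ k, (if i = P k then w j k else 0) := by
    intro i
    have h := hP (Function.update P j i)
    have hg : ∀ Q : ι → κ, ∑ x, ∑ y, (if Q x = Q y then w x y else 0) = _ := fun Q =>
      sum_sum_eq_erase_add_two_mul (fun x y => if Q x = Q y then w x y else 0)
        (fun x y => by simp only [hsymm x y, eq_comm]) j (by simp [hdiag])
    simp only [hg] at h
    have hrest : ∑ x ∈ Finset.univ.erase j, ∑ y ∈ Finset.univ.erase j,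
          (if Function.update P j i x = Function.update P j i y then w x y else 0) =
        ∑ x ∈ Finset.univ.erase j, ∑ y ∈ Finset.univ.erase j,
          (if P x = P y then w x y else 0) := by
      refine Finset.sum_congr rfl fun x hx => Finset.sum_congr rfl fun y hy => ?_
      rw [Function.update_of_ne (Finset.ne_of_mem_erase hx),
        Function.update_of_ne (Finset.ne_of_mem_erase hy)]
    have hrow : ∑ y, (if Function.update P j i j = Function.update P j i y then w j y else 0) =
        ∑ y, (if i = P y then w j y else 0) := by
      refine Finset.sum_congr rfl fun y _ => ?_
      rcases eq_or_ne y j with rfl | hy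
      · simp [hdiag]
      · rw [Function.update_self, Function.update_of_ne hy]
    rw [hrest, hrow] at h
    linarith
  calc Fintype.card κ * ∑ k, (if P j = P k then w j k else 0)
      = ∑ _i : κ, ∑ k, (if P j = P k then w j k else 0) := by simp
    _ ≤ ∑ i : κ, ∑ k, (if i = P k then w j k else 0) := Finset.sum_le_sum fun i _ => hmove i
    _ = ∑ k, w j k := by rw [Finset.sum_comm]; simp
    _ ≤ B := hB j

/-- The infinite version of `exists_coloring_sum_le`, by a limit along an ultrafilter. -/
theorem exists_nat_coloring_sum_le {κ : Type*} [Fintype κ] [Nonempty κ] [DecidableEq κ]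
    (w : ℕ → ℕ → ℝ) (hsymm : ∀ x y, w x y = w y x) (hdiag : ∀ x, w x x = 0)
    (hnonneg : ∀ x y, 0 ≤ w x y) {B : ℝ} (hB : ∀ x, ∀ s : Finset ℕ, ∑ y ∈ s, w x y ≤ B) :
    ∃ P : ℕ → κ, ∀ j, ∀ s : Finset ℕ, (∀ k ∈ s, P k = P j) →
      Fintype.card κ * ∑ k ∈ s, w j k ≤ B := by
  have hfin : ∀ n : ℕ, ∃ Q : ℕ → κ, ∀ j < n,
      Fintype.card κ * ∑ k ∈ Finset.range n, (if Q j = Q k then w j k else 0) ≤ B := by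
    intro n
    obtain ⟨P, hP⟩ := exists_coloring_sum_le (κ := κ) (fun x y : Fin n => w x y)
      (fun x y => hsymm x y) (fun x => hdiag x) (B := B)
      (fun x => by rw [Fin.sum_univ_eq_sum_range (fun y => w x y) n]; exact hB x _)
    refine ⟨fun k => if h : k < n then P ⟨k, h⟩ else Classical.arbitrary κ, fun j hj => ?_⟩
    rw [Finset.sum_range]
    simpa [hj] using hP ⟨j, hj⟩
  choose Q hQ using hfin
  let U : Ultrafilter ℕ := Filter.hyperfilter ℕ
  have hlim : ∀ j, ∃ i, ∀ᶠ n in U, Q n j = i := by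
    intro j
    have h : ∀ᶠ n in U, ∃ i, i ∈ (Set.univ : Set κ) ∧ Q n j = i := by simp
    obtain ⟨i, -, hi⟩ := (Ultrafilter.eventually_exists_mem_iff Set.finite_univ).1 h
    exact ⟨i, hi⟩
  choose P hP using hlim
  refine ⟨P, fun j s hs => ?_⟩
  have hlarge : ∀ᶠ n in U, j < n ∧ s ⊆ Finset.range n := by
    have h : ∀ᶠ n in Filter.atTop, j < n ∧ s ⊆ Finset.range n := by
      filter_upwards [Filter.eventually_gt_atTop j,
        Filter.eventually_gt_atTop (s.sup id)] with n hn hsn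
      exact ⟨hn, fun k hk => Finset.mem_range.2 ((Finset.le_sup (f := id) hk).trans_lt hsn)⟩
    exact h.filter_mono Nat.hyperfilter_le_atTop
  have hagree : ∀ᶠ n in U, ∀ k ∈ s, Q n k = P k :=
    (Filter.eventually_all_finset s).2 fun k _ => hP k
  obtain ⟨n, ⟨hjn, hsn⟩, hsP, hjP⟩ := (hlarge.and (hagree.and (hP j))).exists
  refine le_trans ?_ (hQ n j hjn)
  gcongr
  calc ∑ k ∈ s, w j k = ∑ k ∈ s, (if Q n j = Q n k then w j k else 0) :=
        Finset.sum_congr rfl fun k hk => by rw [hsP k hk, hjP, hs k hk, if_pos rfl]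
    _ ≤ _ := Finset.sum_le_sum_of_subset_of_nonneg hsn fun k _ _ => by
        split_ifs <;> simp [hnonneg]

/-- Schur's test for a finite symmetric nonnegative kernel. -/
theorem sum_sum_mul_mul_le {ι : Type*} (s : Finset ι) (w : ι → ι → ℝ)
    (hsymm : ∀ x y, w x y = w y x) (hnonneg : ∀ x y, 0 ≤ w x y) {θ : ℝ}
    (hθ : ∀ j ∈ s, ∑ k ∈ s, w j k ≤ θ) (x : ι → ℝ) :
    ∑ j ∈ s, ∑ k ∈ s, w j k * (x j * x k) ≤ θ * ∑ j ∈ s, x j ^ 2 := by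
  have hswap : ∑ j ∈ s, ∑ k ∈ s, w j k * x k ^ 2 = ∑ j ∈ s, ∑ k ∈ s, w j k * x j ^ 2 := by
    rw [Finset.sum_comm]
    simp only [hsymm]
  calc ∑ j ∈ s, ∑ k ∈ s, w j k * (x j * x k)
      ≤ ∑ j ∈ s, ∑ k ∈ s, (w j k * x j ^ 2 / 2 + w j k * x k ^ 2 / 2) := by
        refine Finset.sum_le_sum fun j _ => Finset.sum_le_sum fun k _ => ?_
        nlinarith [mul_nonneg (hnonneg j k) (sq_nonneg (x j - x k))]
    _ = ∑ j ∈ s, ∑ k ∈ s, w j k * x j ^ 2 := by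
        simp only [Finset.sum_add_distrib, ← Finset.sum_div]
        rw [hswap]
        ring
    _ ≤ θ * ∑ j ∈ s, x j ^ 2 := by
        rw [Finset.mul_sum]
        refine Finset.sum_le_sum fun j hj => ?_
        rw [← Finset.sum_mul]
        exact mul_le_mul_of_nonneg_right (hθ j hj) (sq_nonneg _)

/-- Unit vectors whose Gram matrix has off-diagonal absolute row sums at most `θ` are
orthonormal up to a relative error `θ`. -/
theorem abs_norm_sum_smul_sq_sub_le {ι H : Type*} [DecidableEq ι] [NormedAddCommGroup H]
    [InnerProductSpace ℂ H] (f : ι → H) (hunit : ∀ n, ‖f n‖ = 1) (s : Finset ι) {θ : ℝ}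
    (hθ : ∀ j ∈ s, ∑ k ∈ s, (if j = k then 0 else ‖⟪f j, f k⟫_ℂ‖) ≤ θ) (c : ι → ℂ) :
    |‖∑ k ∈ s, c k • f k‖ ^ 2 - ∑ k ∈ s, ‖c k‖ ^ 2| ≤ θ * ∑ k ∈ s, ‖c k‖ ^ 2 := by
  have hexp : ((‖∑ k ∈ s, c k • f k‖ ^ 2 - ∑ k ∈ s, ‖c k‖ ^ 2 : ℝ) : ℂ) =
      ∑ j ∈ s, ∑ k ∈ s, if j = k then 0 else ⟪c j • f j, c k • f k⟫_ℂ := by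
    have hnorm : ∀ v : H, (‖v‖ : ℂ) ^ 2 = ⟪v, v⟫_ℂ := fun v =>
      (inner_self_eq_norm_sq_to_K (𝕜 := ℂ) v).symm
    have hdiag : ∀ j, (‖c j‖ : ℂ) ^ 2 = ⟪c j • f j, c j • f j⟫_ℂ := fun j => by
      rw [← hnorm, norm_smul, hunit, mul_one]
    push_cast
    rw [hnorm, sum_inner, ← Finset.sum_sub_distrib]
    refine Finset.sum_congr rfl fun j hj => ?_
    rw [inner_sum, hdiag, ← Finset.sum_erase_eq_sub hj]
    refine Eq.trans ?_ (Finset.sum_erase s (a := j) (by simp))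
    exact Finset.sum_congr rfl fun k hk => (if_neg (Finset.ne_of_mem_erase hk).symm).symm
  rw [← Real.norm_eq_abs, ← Complex.norm_real, hexp]
  refine le_trans ?_ (sum_sum_mul_mul_le s (fun j k => if j = k then 0 else ‖⟪f j, f k⟫_ℂ‖)
    (fun x y => by simp only [norm_inner_symm (f x), eq_comm])
    (fun x y => by split_ifs <;> positivity) hθ fun k => ‖c k‖)
  refine (norm_sum_le _ _).trans (Finset.sum_le_sum fun j _ => (norm_sum_le _ _).trans
    (Finset.sum_le_sum fun k _ => ?_))
  split_ifs
  · simp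
  · rw [inner_smul_left, inner_smul_right, norm_mul, norm_mul, RCLike.norm_conj]
    exact le_of_eq (by ring)

/-- **Theorem (Gavruta).** Every Bessel–Schur sequence of unit vectors, i.e. a sequence
`(f n)` of unit vectors with `∑_{k} |⟨f j, f k⟩| ≤ B` for all `j` (phrased via finite
partial sums), can be partitioned into finitely many Riesz sequences.  The partition of `ℕ`
into `N` sets is encoded by a function `P : ℕ → Fin N` whose fibers are the pieces. -/
theorem feichtinger_stmt1
    {H : Type*} [NormedAddCommGroup H] [InnerProductSpace ℂ H] [CompleteSpace H]
    (f : ℕ → H)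
    (hunit : ∀ n, ‖f n‖ = 1)
    (hSchur : ∃ B > (0 : ℝ), ∀ j : ℕ, ∀ s : Finset ℕ,
      ∑ k ∈ s, ‖⟪f j, f k⟫_ℂ‖ ≤ B) :
    ∃ N : ℕ, ∃ P : ℕ → Fin N, ∀ p : Fin N,
      ∃ A > (0 : ℝ), ∃ B > (0 : ℝ), ∀ c : ℕ →₀ ℂ, (∀ k ∈ c.support, P k = p) →
        A * ∑ k ∈ c.support, ‖c k‖ ^ 2 ≤ ‖∑ k ∈ c.support, c k • f k‖ ^ 2 ∧
        ‖∑ k ∈ c.support, c k • f k‖ ^ 2 ≤ B * ∑ k ∈ c.support, ‖c k‖ ^ 2 := by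
  obtain ⟨B, hB, hS⟩ := hSchur
  obtain ⟨n, hn⟩ := exists_nat_ge (2 * B)
  let w : ℕ → ℕ → ℝ := fun j k => if j = k then 0 else ‖⟪f j, f k⟫_ℂ‖
  obtain ⟨P, hP⟩ := exists_nat_coloring_sum_le (κ := Fin (n + 1)) w
    (fun x y => by simp only [w, norm_inner_symm (f x), eq_comm]) (fun x => if_pos rfl)
    (fun x y => by simp only [w]; split_ifs <;> positivity)
    (fun x s => (Finset.sum_le_sum fun y _ => by
      simp only [w]; split_ifs <;> simp).trans (hS x s))
  refine ⟨n + 1, P, fun p => ⟨1 / 2, by norm_num, 3 / 2, by norm_num, fun c hc => ?_⟩⟩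
  have hrow : ∀ j ∈ c.support, ∑ k ∈ c.support, w j k ≤ 1 / 2 := by
    intro j hj
    have h := hP j c.support fun k hk => (hc k hk).trans (hc j hj).symm
    rw [Fintype.card_fin, Nat.cast_add_one] at h
    by_contra! hlt
    nlinarith
  have h := abs_le.1 (abs_norm_sum_smul_sq_sub_le f hunit c.support hrow c)
  constructor <;> linarith [h.1, h.2]
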